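/- arXiv:2101.00988 — 4 statements merged into one kernel-verified Lean document; each statement's English description precedes it below -/
import Mathlib

section
/- Every 5×5 matrix with entries in {0,1} that is invertible over ℤ/2 has integer determinant of absolute value at most 5. -/
/-- AM-GM for six eigenvalues with sum 36. -/
theorem prod_le_of_sum {ι : Type*} [Fintype ι] (hc : Fintype.card ι = 6) (z : ι → ℝ)
    (hz : ∀ i, 0 ≤ z i) (hs : ∑ i, z i = 36) : ∏ i, z i ≤ 6 ^ 6 := by
  have h1 : ∏ i, (z i / 6) ≤ ∏ i, Real.exp (z i / 6 - 1) := by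
    apply Finset.prod_le_prod
    · intro i _
      have := hz i
      positivity
    · intro i _
      have := Real.add_one_le_exp (z i / 6 - 1)
      linarith
  rw [← Real.exp_sum, Finset.sum_sub_distrib, ← Finset.sum_div, hs, Finset.prod_div_distrib] at h1
  simp [hc] at h1
  norm_num at h1
  rw [div_le_one (by norm_num)] at h1
  norm_num
  exact h1

/-- Hadamard's bound for `6 × 6` real matrices with entries of square one. -/
theorem det_sq_le {ι : Type*} [Fintype ι] [DecidableEq ι] (hc : Fintype.card ι = 6)
    (S : Matrix ι ι ℝ) (hS : ∀ i j, S i j * S i j = 1) : S.det ^ 2 ≤ 6 ^ 6 := by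
  have hp : (S * S.conjTranspose).PosSemidef := Matrix.posSemidef_self_mul_conjTranspose S
  have hd := hp.1.det_eq_prod_eigenvalues
  have ht := hp.1.trace_eq_sum_eigenvalues
  have htr : (S * S.conjTranspose).trace = 36 := by
    simp [Matrix.trace, Matrix.mul_apply, hS, hc]
    norm_num
  rw [htr] at ht
  have := prod_le_of_sum hc hp.1.eigenvalues hp.eigenvalues_nonneg (by simpa using ht.symm)
  have h2 : (S * S.conjTranspose).det = S.det ^ 2 := by
    rw [Matrix.det_mul, Matrix.det_conjTranspose]
    simp [sq]
  rw [← h2, hd]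
  simpa using this

/-- Every 5×5 binary matrix invertible over ℤ/2 has integer determinant
of absolute value at most 5. -/
theorem stmt_3 (M : Matrix (Fin 5) (Fin 5) ℤ)
    (hbin : ∀ i j, M i j = 0 ∨ M i j = 1)
    (hinv : (M.map (Int.cast : ℤ → ZMod 2)).det ≠ 0) :
    |M.det| ≤ 5 := by
  have hodd : M.det % 2 ≠ 0 := by
    intro h
    apply hinv
    have h1 : ((M.det : ℤ) : ZMod 2) = (M.map (Int.cast : ℤ → ZMod 2)).det :=
      Int.cast_det M
    rw [← h1, ZMod.intCast_zmod_eq_zero_iff_dvd]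
    exact Int.dvd_of_emod_eq_zero h
  let R : Matrix (Fin 5) (Fin 5) ℝ := M.map (Int.cast : ℤ → ℝ)
  have hR : R.det = (M.det : ℝ) := (Int.cast_det M).symm
  let B : Matrix Unit (Fin 5) ℝ := Matrix.of fun _ _ => 1
  let C : Matrix (Fin 5) Unit ℝ := Matrix.of fun _ _ => -1
  let D : Matrix (Fin 5) (Fin 5) ℝ := Matrix.of fun i j => 2 * R i j - 1
  have hDC : D - C * B = (2 : ℝ) • R := by
    ext i j
    simp [D, C, B, Matrix.mul_apply]
  have hdet : (Matrix.fromBlocks 1 B C D).det = 32 * (M.det : ℝ) := by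
    rw [Matrix.det_fromBlocks_one₁₁, hDC, Matrix.det_smul, hR]
    norm_num
  have hb := det_sq_le (by simp) (Matrix.fromBlocks 1 B C D) (by
    rintro (i | i) (j | j)
    · simp
    · simp [B]
    · simp [C]
    · rcases hbin i j with h | h <;> simp [D, R, h] <;> norm_num)
  rw [hdet] at hb
  have hb' : (32 * M.det) ^ 2 ≤ 6 ^ 6 := by exact_mod_cast hb
  have h7 : |M.det| < 7 := by
    apply abs_lt_of_sq_lt_sq _ (by norm_num)
    nlinarith
  rw [abs_lt] at h7
  rw [abs_le]
  omega
end

section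
/- If a 5×5 matrix M with entries in {0,1} is invertible over ℤ/2 and has integer determinant ±5, then there exist indices i, j with M(i,j) = 1 such that the 4×4 minor of M obtained by deleting row i and column j has integer determinant ±3. -/
namespace Stmt4

/-- bit `p` of the code `a`, as an integer -/
def e (a p : ℕ) : ℤ := Int.ofNat ((a >>> p) % 2)

/-- 2×2 minors -/
def m2 (a b p q : ℕ) : ℤ := e a p * e b q - e a q * e b p
/-- 3×3 minors -/
def m3 (a b c p q r : ℕ) : ℤ := e c p * m2 a b q r - e c q * m2 a b p r + e c r * m2 a b p q
/-- 4×4 minors, expanded along the last row -/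
def m4 (a b c d p q r s : ℕ) : ℤ :=
  e d s * m3 a b c p q r - e d r * m3 a b c p q s + e d q * m3 a b c p r s - e d p * m3 a b c q r s
/-- 5×5 determinant, expanded along the last row -/
def m5 (a b c d f : ℕ) : ℤ :=
  e f 0 * m4 a b c d 1 2 3 4 - e f 1 * m4 a b c d 0 2 3 4 + e f 2 * m4 a b c d 0 1 3 4
    - e f 3 * m4 a b c d 0 1 2 4 + e f 4 * m4 a b c d 0 1 2 3

/-- the codes of the rows with at least three ones -/
def L : List ℕ := [7,11,13,14,15,19,21,22,23,25,26,27,28,29,30,31]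

/-- some entry one in the row `f` has a minor `±3` with respect to the other rows -/
def rowGood (a b c d f : ℕ) : Bool :=
  (Int.natAbs (e f 0 * m4 a b c d 1 2 3 4) == 3) || (Int.natAbs (e f 1 * m4 a b c d 0 2 3 4) == 3) ||
  (Int.natAbs (e f 2 * m4 a b c d 0 1 3 4) == 3) || (Int.natAbs (e f 3 * m4 a b c d 0 1 2 4) == 3) ||
  (Int.natAbs (e f 4 * m4 a b c d 0 1 2 3) == 3)

/-- test for one matrix -/
def leaf (a b c d f : ℕ) : Bool :=
  !(Nat.beq (Int.natAbs (m5 a b c d f)) 5) || rowGood a b c d f || rowGood a b c f d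
    || rowGood a b d f c || rowGood a c d f b || rowGood b c d f a

/-- the whole test -/
def check : Bool :=
  L.all fun a => L.all fun b => !(Nat.blt a b) || L.all fun c => !(Nat.blt b c) ||
    L.all fun d => !(Nat.blt c d) || L.all fun f => !(Nat.blt d f) || leaf a b c d f

theorem check_true : check = true := by decide +kernel

/-- bound test for three rows of a 4×4 matrix -/
def bnd (a b c : ℕ) : Bool :=
  Nat.ble (Int.toNat (m3 a b c 0 1 2) + Int.toNat (-m3 a b c 0 1 3) + Int.toNat (m3 a b c 0 2 3)
    + Int.toNat (-m3 a b c 1 2 3)) 3 &&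
  Nat.ble (Int.toNat (-m3 a b c 0 1 2) + Int.toNat (m3 a b c 0 1 3) + Int.toNat (-m3 a b c 0 2 3)
    + Int.toNat (m3 a b c 1 2 3)) 3

theorem bnd_true : ((List.range 16).all fun a => (List.range 16).all fun b =>
    (List.range 16).all fun c => bnd a b c) = true := by decide +kernel

theorem det4 (B : Matrix (Fin 4) (Fin 4) ℤ) (k p : Fin 4 → ℕ)
    (h : ∀ i j, B i j = e (k i) (p j)) :
    B.det = m4 (k 0) (k 1) (k 2) (k 3) (p 0) (p 1) (p 2) (p 3) := by
  have hB : B = Matrix.of fun i j => e (k i) (p j) := by ext i j; exact h i j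
  subst hB
  simp [Matrix.det_succ_row_zero, Fin.sum_univ_succ, Fin.succAbove, m4, m3, m2]
  ring

theorem det5 (B : Matrix (Fin 5) (Fin 5) ℤ) (k : Fin 5 → ℕ)
    (h : ∀ i j : Fin 5, B i j = e (k i) (j : ℕ)) :
    B.det = m5 (k 0) (k 1) (k 2) (k 3) (k 4) := by
  rw [Matrix.det_succ_row B 4]
  have h4 : ∀ j : Fin 5, (B.submatrix (Fin.succAbove 4) j.succAbove).det =
      m4 (k 0) (k 1) (k 2) (k 3) (j.succAbove 0 : Fin 5) (j.succAbove 1 : Fin 5)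
        (j.succAbove 2 : Fin 5) (j.succAbove 3 : Fin 5) := fun j =>
    det4 _ (fun i => k (Fin.succAbove 4 i)) (fun i => (j.succAbove i : Fin 5)) (fun i l => h _ _)
  simp only [h4, h, Fin.sum_univ_five, m5]
  simp [Fin.succAbove, Fin.lt_def]
  ring

theorem e_cases (a p : ℕ) : e a p = 0 ∨ e a p = 1 := by
  unfold e
  rcases Nat.mod_two_eq_zero_or_one (a >>> p) with h | h <;> simp [h]

theorem code4 : ∀ b : Fin 4 → Bool, ∃ k ∈ List.range 16, ∀ j : Fin 4,
    (if b j then (1 : ℤ) else 0) = e k (j : ℕ) := by decide +kernel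

theorem code5 : ∀ b : Fin 5 → Bool, 3 ≤ ∑ j, (if b j then (1 : ℤ) else 0) →
    ∃ k ∈ L, ∀ j : Fin 5, (if b j then (1 : ℤ) else 0) = e k (j : ℕ) := by decide +kernel

theorem bool_of_bin {n : ℕ} (v : Fin n → ℤ) (h : ∀ j, v j = 0 ∨ v j = 1) :
    v = fun j => if (decide (v j = 1)) then (1 : ℤ) else 0 := by
  ext j
  rcases h j with h | h <;> simp [h]

theorem bound4 (B : Matrix (Fin 4) (Fin 4) ℤ) (h : ∀ i j, B i j = 0 ∨ B i j = 1) :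
    |B.det| ≤ 3 := by
  have hk : ∀ i, ∃ k ∈ List.range 16, ∀ j : Fin 4, B i j = e k (j : ℕ) := by
    intro i
    obtain ⟨k, hk, hj⟩ := code4 (fun j => decide (B i j = 1))
    refine ⟨k, hk, fun j => ?_⟩
    rw [← hj j]
    exact congrFun (bool_of_bin (B i) (h i)) j
  choose k hk hB using hk
  rw [det4 B k (fun j => (j : ℕ)) hB]
  have hb := bnd_true
  simp only [List.all_eq_true] at hb
  have hb := hb _ (hk 0) _ (hk 1) _ (hk 2)
  simp only [bnd, Bool.and_eq_true, Nat.ble_eq] at hb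
  obtain ⟨h1, h2⟩ := hb
  simp only [m4]
  change |e (k 3) 3 * m3 (k 0) (k 1) (k 2) 0 1 2 - e (k 3) 2 * m3 (k 0) (k 1) (k 2) 0 1 3
    + e (k 3) 1 * m3 (k 0) (k 1) (k 2) 0 2 3 - e (k 3) 0 * m3 (k 0) (k 1) (k 2) 1 2 3| ≤ 3
  generalize m3 (k 0) (k 1) (k 2) 0 1 2 = x at *
  generalize m3 (k 0) (k 1) (k 2) 0 1 3 = y at *
  generalize m3 (k 0) (k 1) (k 2) 0 2 3 = z at *
  generalize m3 (k 0) (k 1) (k 2) 1 2 3 = w at *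
  rw [abs_le]
  rcases e_cases (k 3) 0 with h0 | h0 <;> rcases e_cases (k 3) 1 with h1 | h1 <;>
  rcases e_cases (k 3) 2 with h2 | h2 <;> rcases e_cases (k 3) 3 with h3 | h3 <;>
  rw [h0, h1, h2, h3] <;> omega

theorem abs_adj {n : ℕ} (M : Matrix (Fin (n+1)) (Fin (n+1)) ℤ) (i j : Fin (n+1)) :
    |M.adjugate j i| = |(M.submatrix i.succAbove j.succAbove).det| := by
  rw [Matrix.adjugate_fin_succ_eq_det_submatrix, abs_mul, abs_pow]
  simp

theorem abs_adj_perm (M : Matrix (Fin 5) (Fin 5) ℤ) (σ : Equiv.Perm (Fin 5)) (i j : Fin 5) :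
    |(M.submatrix σ id).adjugate j i| = |M.adjugate j (σ i)| := by
  rw [Matrix.adjugate_apply, Matrix.adjugate_apply]
  have : (M.submatrix σ id).updateRow i (Pi.single j 1) =
      (M.updateRow (σ i) (Pi.single j 1)).submatrix σ (Equiv.refl (Fin 5)) := by
    ext a b
    simp [Matrix.updateRow_apply]
  rw [this, Matrix.abs_det_submatrix_equiv_equiv]

/-- sorted case -/
theorem sorted_case (N : Matrix (Fin 5) (Fin 5) ℤ) (k : Fin 5 → ℕ) (hk : ∀ i, k i ∈ L)
    (hs : StrictMono k) (hN : ∀ i j : Fin 5, N i j = e (k i) (j : ℕ)) (hd : |N.det| = 5) :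
    ∃ i j : Fin 5, N i j = 1 ∧ |N.adjugate j i| = 3 := by
  by_contra hcon
  push Not at hcon
  have key : ∀ i j : Fin 5, Int.natAbs (e (k i) (j : ℕ) *
      m4 (k (i.succAbove 0)) (k (i.succAbove 1)) (k (i.succAbove 2)) (k (i.succAbove 3))
        (j.succAbove 0 : Fin 5) (j.succAbove 1 : Fin 5)
        (j.succAbove 2 : Fin 5) (j.succAbove 3 : Fin 5)) ≠ 3 := by
    intro i j
    rcases e_cases (k i) j with h | h
    · simp [h]
    · have := hcon i j (by rw [hN, h])
      rw [abs_adj, det4 (N.submatrix i.succAbove j.succAbove) (fun l => k (i.succAbove l)) (fun l => (j.succAbove l : Fin 5))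
        (fun _ _ => hN _ _), Int.abs_eq_natAbs] at this
      rw [h, one_mul]
      exact_mod_cast this
  have hc := check_true
  simp only [check, List.all_eq_true, Bool.or_eq_true, Bool.not_eq_true', ← Bool.not_eq_true,
    Nat.blt_eq, ← imp_iff_not_or] at hc
  have hl := hc _ (hk 0) _ (hk 1) (hs (by decide)) _ (hk 2) (hs (by decide)) _ (hk 3)
    (hs (by decide)) _ (hk 4) (hs (by decide))
  have h5 : Nat.beq (Int.natAbs (m5 (k 0) (k 1) (k 2) (k 3) (k 4))) 5 = true := by
    rw [← det5 N k hN, Nat.beq_eq]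
    rw [Int.abs_eq_natAbs] at hd
    exact_mod_cast hd
  have row : ∀ i : Fin 5, rowGood (k (i.succAbove 0)) (k (i.succAbove 1)) (k (i.succAbove 2))
      (k (i.succAbove 3)) (k i) = false := by
    intro i
    have k0 := key i 0
    have k1 := key i 1
    have k2 := key i 2
    have k3 := key i 3
    have k4 := key i 4
    simp only [rowGood, Bool.or_eq_false_iff, beq_eq_false_iff_ne]
    exact ⟨⟨⟨⟨k0, k1⟩, k2⟩, k3⟩, k4⟩
  have r0 : rowGood (k 1) (k 2) (k 3) (k 4) (k 0) = false := row 0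
  have r1 : rowGood (k 0) (k 2) (k 3) (k 4) (k 1) = false := row 1
  have r2 : rowGood (k 0) (k 1) (k 3) (k 4) (k 2) = false := row 2
  have r3 : rowGood (k 0) (k 1) (k 2) (k 4) (k 3) = false := row 3
  have r4 : rowGood (k 0) (k 1) (k 2) (k 3) (k 4) = false := row 4
  simp [leaf, h5, r0, r1, r2, r3, r4] at hl

end Stmt4

open Stmt4 in
/-- A 5×5 binary matrix invertible over ℤ/2 with integer determinant ±5 has a 4×4
minor of determinant ±3 located at an entry equal to 1. -/
theorem stmt_4 (M : Matrix (Fin 5) (Fin 5) ℤ)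
    (hbin : ∀ i j, M i j = 0 ∨ M i j = 1)
    (hinv : (M.map (Int.cast : ℤ → ZMod 2)).det ≠ 0)
    (hdet : M.det = 5 ∨ M.det = -5) :
    ∃ i j : Fin 5, M i j = 1 ∧
      ((M.submatrix i.succAbove j.succAbove).det = 3 ∨
       (M.submatrix i.succAbove j.succAbove).det = -3) := by
  have hd : |M.det| = 5 := by rcases hdet with h | h <;> simp [h]
  by_contra hcon
  have hno : ∀ i j, M i j = 1 → |M.adjugate j i| ≠ 3 := by
    intro i j hij h3
    rw [abs_adj] at h3
    exact hcon ⟨i, j, hij, eq_or_eq_neg_of_abs_eq h3⟩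
  have hle : ∀ i j, |M.adjugate j i| ≤ 3 := by
    intro i j
    rw [abs_adj]
    exact bound4 _ fun _ _ => hbin _ _
  have hw : ∀ i, 3 ≤ ∑ j, M i j := by
    intro i
    have h1 : |M.det| ≤ ∑ j, 2 * M i j := by
      rw [Matrix.det_eq_sum_mul_adjugate_row M i]
      refine (Finset.abs_sum_le_sum_abs _ _).trans (Finset.sum_le_sum fun j _ => ?_)
      have h3 := hle i j
      rcases hbin i j with h | h
      · simp [h]
      · have := hno i j h
        rw [h, one_mul]
        omega
    rw [← Finset.mul_sum] at h1
    omega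
  have hk : ∀ i, ∃ k ∈ L, ∀ j : Fin 5, M i j = e k (j : ℕ) := by
    intro i
    have hb := bool_of_bin (M i) (hbin i)
    obtain ⟨k, hk, hj⟩ := code5 (fun j => decide (M i j = 1)) (by
      have := hw i
      rw [Finset.sum_congr rfl (fun j _ => congrFun hb j)] at this
      exact this)
    exact ⟨k, hk, fun j => (congrFun hb j).trans (hj j)⟩
  choose k hkL hkM using hk
  have hinj : Function.Injective k := by
    intro a b hab
    by_contra hne
    have : M.det = 0 := Matrix.det_zero_of_row_eq hne (by
      ext j
      rw [hkM, hkM, hab])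
    rw [this] at hd
    norm_num at hd
  let σ := Tuple.sort k
  have hs : StrictMono (k ∘ σ) :=
    (Tuple.monotone_sort k).strictMono_of_injective (hinj.comp σ.injective)
  obtain ⟨i, j, hij, h3⟩ := sorted_case (M.submatrix σ id) (k ∘ σ) (fun i => hkL _) hs
    (fun i j => hkM _ _) (by
      have := Matrix.abs_det_submatrix_equiv_equiv σ (Equiv.refl (Fin 5)) M
      exact this.trans hd)
  rw [abs_adj_perm] at h3
  exact hno (σ i) j hij h3
end

section
/- If a 5×5 matrix M with entries in {0,1} is invertible over ℤ/2 and has integer determinant ±5, then no column of M is a standard basis vector (i.e., no column has exactly one nonzero entry) and no column of M is the all-ones vector. -/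
/-- 0/1 value of a Boolean as an integer. -/
def bz (b : Bool) : ℤ := cond b 1 0

/-- A 3×3 determinant. -/
def d3 (a b c d e f g h i : ℤ) : ℤ :=
  a * (e * i - f * h) - b * (d * i - f * g) + c * (d * h - e * g)

/-- All signed subset sums of the four numbers are bounded by 3: Boolean test. -/
def okTest (p q r t : ℤ) : Bool :=
  Nat.ble (p.toNat + (-q).toNat + r.toNat + (-t).toNat) 3 &&
  Nat.ble ((-p).toNat + q.toNat + (-r).toNat + t.toNat) 3

lemma okTest_bound (p q r t : ℤ) (h : okTest p q r t = true) (x0 x1 x2 x3 : Bool) :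
    (bz x0 * p - bz x1 * q + bz x2 * r - bz x3 * t).natAbs ≤ 3 := by
  simp only [okTest, Bool.and_eq_true, Nat.ble_eq] at h
  obtain ⟨h1, h2⟩ := h
  cases x0 <;> cases x1 <;> cases x2 <;> cases x3 <;> simp only [bz, cond] <;> omega

lemma key12 : ∀ a0 a1 a2 a3 b0 b1 b2 b3 c0 c1 c2 c3 : Bool, okTest
    (d3 (bz a1) (bz a2) (bz a3) (bz b1) (bz b2) (bz b3) (bz c1) (bz c2) (bz c3))
    (d3 (bz a0) (bz a2) (bz a3) (bz b0) (bz b2) (bz b3) (bz c0) (bz c2) (bz c3))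
    (d3 (bz a0) (bz a1) (bz a3) (bz b0) (bz b1) (bz b3) (bz c0) (bz c1) (bz c3))
    (d3 (bz a0) (bz a1) (bz a2) (bz b0) (bz b1) (bz b2) (bz c0) (bz c1) (bz c2)) = true := by
  decide +kernel

lemma det4 (A : Matrix (Fin 4) (Fin 4) ℤ) (h : ∀ i j, A i j = 0 ∨ A i j = 1) :
    A.det.natAbs ≤ 3 := by
  have hb : ∀ i j, ∃ b : Bool, A i j = bz b := fun i j => by
    rcases h i j with h | h
    · exact ⟨false, h⟩
    · exact ⟨true, h⟩
  choose B hB using hb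
  have hk := okTest_bound _ _ _ _ (key12 (B 1 0) (B 1 1) (B 1 2) (B 1 3) (B 2 0) (B 2 1) (B 2 2) (B 2 3)
    (B 3 0) (B 3 1) (B 3 2) (B 3 3)) (B 0 0) (B 0 1) (B 0 2) (B 0 3)
  simp only [← hB] at hk
  convert hk using 2
  rw [Matrix.det_succ_row_zero]
  simp [Fin.sum_univ_succ, Matrix.det_fin_three, Fin.succAbove, d3]
  ring

lemma sgn_mul (n : ℕ) (x : ℤ) : ((-1 : ℤ) ^ n * x).natAbs = x.natAbs := by
  rw [Int.natAbs_mul, Int.natAbs_pow]; simp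

lemma col_single (M : Matrix (Fin 5) (Fin 5) ℤ) (i j : Fin 5) (h1 : M i j = 1)
    (h0 : ∀ k, k ≠ i → M k j = 0) :
    M.det.natAbs = (M.submatrix i.succAbove j.succAbove).det.natAbs := by
  rw [Matrix.det_succ_column M j, Finset.sum_eq_single i]
  · rw [h1, mul_one, sgn_mul]
  · intro k _ hk
    rw [h0 k hk]; ring
  · simp

/-- A 5×5 binary matrix invertible over ℤ/2 with integer determinant ±5 has no column
with exactly one nonzero entry and no all-ones column. -/
theorem stmt_5 (M : Matrix (Fin 5) (Fin 5) ℤ)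
    (hbin : ∀ i j, M i j = 0 ∨ M i j = 1)
    (hinv : (M.map (Int.cast : ℤ → ZMod 2)).det ≠ 0)
    (hdet : M.det = 5 ∨ M.det = -5) :
    ∀ j : Fin 5,
      (Finset.univ.filter fun i => M i j ≠ 0).card ≠ 1 ∧
      ¬ (∀ i, M i j = 1) := by
  intro j
  have h5 : M.det.natAbs = 5 := by
    rcases hdet with h | h <;> rw [h] <;> rfl
  constructor
  · intro hc
    obtain ⟨i, hi⟩ := Finset.card_eq_one.mp hc
    have hmem : ∀ k, M k j ≠ 0 ↔ k = i := fun k => by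
      have := Finset.ext_iff.mp hi k
      simpa using this
    have h1 : M i j = 1 := (hbin i j).resolve_left ((hmem i).2 rfl)
    have h0 : ∀ k, k ≠ i → M k j = 0 := fun k hk => by
      by_contra h
      exact hk ((hmem k).1 h)
    have := col_single M i j h1 h0
    have := det4 (M.submatrix i.succAbove j.succAbove) (fun a b => hbin _ _)
    omega
  · intro hone
    let N : Matrix (Fin 5) (Fin 5) ℤ := fun i k => if i = 0 then M i k else M i k - M 0 k
    have hN : M.det = N.det := by
      refine Matrix.det_eq_of_forall_row_eq_smul_add_const (fun i => if i = 0 then 0 else 1) 0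
        (by simp) ?_
      intro i k
      by_cases hi : i = 0 <;> simp [N, hi]
    have h1 := col_single N 0 j (by simp [N, hone]) (fun k hk => by simp [N, hk, hone])
    let s : Fin 4 → ℤ := fun k => 1 - 2 * M 0 (j.succAbove k)
    let B : Matrix (Fin 4) (Fin 4) ℤ := fun i k =>
      s k * (M i.succ (j.succAbove k) - M 0 (j.succAbove k))
    have hs : ∀ k, s k = 1 ∨ s k = -1 := fun k => by
      rcases hbin 0 (j.succAbove k) with h | h <;> simp [s, h]
    have hB : ∀ i k, B i k = 0 ∨ B i k = 1 := fun i k => by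
      rcases hbin 0 (j.succAbove k) with h | h <;>
        rcases hbin i.succ (j.succAbove k) with h' | h' <;> simp [B, s, h, h']
    have hA : N.submatrix (Fin.succAbove 0) j.succAbove = Matrix.of fun i k => s k * B i k := by
      ext i k
      have : s k * s k = 1 := by rcases hs k with h | h <;> rw [h] <;> rfl
      rw [Matrix.submatrix_apply, Matrix.of_apply]
      simp [N, B, ← mul_assoc, this]
    rw [hA, Matrix.det_mul_row, Int.natAbs_mul] at h1
    have hp : (∏ k, s k).natAbs = 1 := by
      rw [← Int.natAbsHom_apply, map_prod]
      refine Finset.prod_eq_one fun k _ => ?_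
      rcases hs k with h | h <;> rw [h] <;> rfl
    rw [hp, one_mul, ← hN] at h1
    have := det4 B hB
    omega
end

section
/- If a 5×5 matrix M with entries in {0,1} is invertible over ℤ/2 and has integer determinant ±5, then M is equivalent, up to permutation of rows and columns, to one of exactly three matrices: M₁ with rows (1,1,1,0,0),(1,1,0,1,0),(1,0,1,1,0),(0,1,1,1,1),(1,0,0,0,1); M₂ with rows (1,1,1,0,0),(1,0,0,1,0),(0,1,0,1,0),(0,0,1,1,1),(1,1,0,0,1); and M₃ with rows (1,1,1,0,0),(1,1,0,1,0),(1,0,1,1,1),(0,1,1,1,1),(1,1,0,0,1). -/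
/-- A row of a binary 5×5 matrix. -/
structure R where
  a : Bool
  b : Bool
  c : Bool
  d : Bool
  e : Bool

namespace R

/-- Integer value of a bit. -/
def v (x : Bool) : ℤ := cond x 1 0

/-- Select `m` or `0`. -/
def sel (x : Bool) (m : ℕ) : ℕ := cond x m 0

def get (r : R) : Fin 5 → ℤ := ![v r.a, v r.b, v r.c, v r.d, v r.e]

def n (x : Bool) : ℕ := cond x 1 0

def weight (r : R) : ℕ := n r.a + n r.b + n r.c + n r.d + n r.e

def beq (r s : R) : Bool :=
  (r.a == s.a) && (r.b == s.b) && (r.c == s.c) && (r.d == s.d) && (r.e == s.e)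

theorem eq_of_beq {r s : R} (h : beq r s = true) : r = s := by
  cases r; cases s
  simp [beq] at h
  simp [h]

/-- The row with binary code `k`. -/
def ofNat (k : ℕ) : R := ⟨k.testBit 4, k.testBit 3, k.testBit 2, k.testBit 1, k.testBit 0⟩

def bits : List Bool := [false, true]

/-- All rows. -/
def all : List R :=
  bits.flatMap fun a => bits.flatMap fun b => bits.flatMap fun c => bits.flatMap fun d =>
    bits.flatMap fun e => [⟨a, b, c, d, e⟩]

theorem mem_all (r : R) : r ∈ all := by
  rcases r with ⟨a, b, c, d, e⟩
  cases a <;> cases b <;> cases c <;> cases d <;> cases e <;> simp [all, bits]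

/-- Rows of weight at least `w`. -/
def L (w : ℕ) : List R := all.filter fun r => w.ble r.weight

theorem mem_L {w : ℕ} {r : R} (h : w ≤ r.weight) : r ∈ L w := by
  simp only [L, List.mem_filter]
  exact ⟨mem_all r, Nat.ble_eq.mpr h⟩

/-- The first row in normal form. -/
def canon (w : ℕ) : R := ofNat (2 ^ w - 1)

/-- Run through a list together with its remaining tails. -/
def loop : List R → (R → List R → Bool) → Bool
  | [], _ => true
  | r :: t, f => f r t && loop t f

theorem loop_spec {l : List R} {f : R → List R → Bool} (h : loop l f = true)
    {r : R} {s : List R} (hs : (r :: s).Sublist l) : ∃ t, s.Sublist t ∧ f r t = true := by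
  induction l with
  | nil => cases hs
  | cons x t ih =>
    simp only [loop, Bool.and_eq_true] at h
    cases hs with
    | cons _ hx => exact ih h.2 hx
    | cons_cons _ hx => exact ⟨t, hx, h.1⟩

/-- Pass the 2×2 minors (modulo 16) to `f`, expanding along the last row `r`. -/
def minors2 (r : R) (m0 m1 m2 m3 m4 : ℕ) (f : ℕ → ℕ → ℕ → ℕ → ℕ → ℕ → ℕ → ℕ → ℕ → ℕ → Bool) : Bool :=
  f (15 * sel r.a m1 + sel r.b m0)
    (15 * sel r.a m2 + sel r.c m0)
    (15 * sel r.a m3 + sel r.d m0)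
    (15 * sel r.a m4 + sel r.e m0)
    (15 * sel r.b m2 + sel r.c m1)
    (15 * sel r.b m3 + sel r.d m1)
    (15 * sel r.b m4 + sel r.e m1)
    (15 * sel r.c m3 + sel r.d m2)
    (15 * sel r.c m4 + sel r.e m2)
    (15 * sel r.d m4 + sel r.e m3)

/-- Pass the 3×3 minors (modulo 16) to `f`, expanding along the last row `r`. -/
def minors3 (r : R) (m01 m02 m03 m04 m12 m13 m14 m23 m24 m34 : ℕ) (f : ℕ → ℕ → ℕ → ℕ → ℕ → ℕ → ℕ → ℕ → ℕ → ℕ → Bool) : Bool :=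
  f (sel r.a m12 + 15 * sel r.b m02 + sel r.c m01)
    (sel r.a m13 + 15 * sel r.b m03 + sel r.d m01)
    (sel r.a m14 + 15 * sel r.b m04 + sel r.e m01)
    (sel r.a m23 + 15 * sel r.c m03 + sel r.d m02)
    (sel r.a m24 + 15 * sel r.c m04 + sel r.e m02)
    (sel r.a m34 + 15 * sel r.d m04 + sel r.e m03)
    (sel r.b m23 + 15 * sel r.c m13 + sel r.d m12)
    (sel r.b m24 + 15 * sel r.c m14 + sel r.e m12)
    (sel r.b m34 + 15 * sel r.d m14 + sel r.e m13)
    (sel r.c m34 + 15 * sel r.d m24 + sel r.e m23)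

/-- Pass the 4×4 minors (modulo 16) to `f`, expanding along the last row `r`. -/
def minors4 (r : R) (m012 m013 m014 m023 m024 m034 m123 m124 m134 m234 : ℕ) (f : ℕ → ℕ → ℕ → ℕ → ℕ → Bool) : Bool :=
  f (15 * sel r.a m123 + sel r.b m023 + 15 * sel r.c m013 + sel r.d m012)
    (15 * sel r.a m124 + sel r.b m024 + 15 * sel r.c m014 + sel r.e m012)
    (15 * sel r.a m134 + sel r.b m034 + 15 * sel r.d m014 + sel r.e m013)
    (15 * sel r.a m234 + sel r.c m034 + 15 * sel r.d m024 + sel r.e m023)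
    (15 * sel r.b m234 + sel r.c m134 + 15 * sel r.d m124 + sel r.e m123)

def det5 (r : R) (m0123 m0124 m0134 m0234 m1234 : ℕ) : ℕ :=
  sel r.a m1234 + 15 * sel r.b m0234 + sel r.c m0134 + 15 * sel r.d m0124 + sel r.e m0123

/-- All the solutions with first row in normal form. -/
def table : List (R × R × R × R × R) := [
  (ofNat 3, ofNat 5, ofNat 14, ofNat 22, ofNat 25),
  (ofNat 3, ofNat 6, ofNat 13, ofNat 21, ofNat 26),
  (ofNat 3, ofNat 9, ofNat 14, ofNat 21, ofNat 26),
  (ofNat 3, ofNat 10, ofNat 13, ofNat 22, ofNat 25),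
  (ofNat 3, ofNat 13, ofNat 17, ofNat 22, ofNat 26),
  (ofNat 3, ofNat 14, ofNat 18, ofNat 21, ofNat 25),
  (ofNat 3, ofNat 13, ofNat 21, ofNat 25, ofNat 30),
  (ofNat 3, ofNat 14, ofNat 22, ofNat 26, ofNat 29),
  (ofNat 7, ofNat 11, ofNat 19, ofNat 29, ofNat 30),
  (ofNat 7, ofNat 13, ofNat 21, ofNat 27, ofNat 30),
  (ofNat 7, ofNat 14, ofNat 22, ofNat 27, ofNat 29)]

def leaf (d : ℕ) (r0 r1 r2 r3 r4 : R) : Bool :=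
  cond ((d % 16).beq 5 || (d % 16).beq 11)
    (table.any fun t => beq t.1 r0 && beq t.2.1 r1 && beq t.2.2.1 r2 && beq t.2.2.2.1 r3 &&
      beq t.2.2.2.2 r4) true

def search (r0 : R) (l : List R) : Bool :=
  loop l fun r1 l => minors2 r1 (n r0.a) (n r0.b) (n r0.c) (n r0.d) (n r0.e)
    fun m01 m02 m03 m04 m12 m13 m14 m23 m24 m34 =>
  loop l fun r2 l => minors3 r2 m01 m02 m03 m04 m12 m13 m14 m23 m24 m34
    fun m012 m013 m014 m023 m024 m034 m123 m124 m134 m234 =>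
  loop l fun r3 l => minors4 r3 m012 m013 m014 m023 m024 m034 m123 m124 m134 m234
    fun m0123 m0124 m0134 m0234 m1234 =>
  loop l fun r4 _ => leaf (det5 r4 m0123 m0124 m0134 m0234 m1234) r0 r1 r2 r3 r4

set_option maxRecDepth 100000 in
theorem search1 : search (canon 1) (L 1) = true := by decide +kernel
set_option maxRecDepth 100000 in
theorem search2 : search (canon 2) (L 2) = true := by decide +kernel
set_option maxRecDepth 100000 in
theorem search3 : search (canon 3) (L 3) = true := by decide +kernel
set_option maxRecDepth 100000 in
theorem search4 : search (canon 4) (L 4) = true := by decide +kernel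
set_option maxRecDepth 100000 in
theorem search5 : search (canon 5) (L 5) = true := by decide +kernel

/-- The matrix with given rows. -/
def mat (ρ : Fin 5 → R) : Matrix (Fin 5) (Fin 5) ℤ := fun i => (ρ i).get

/-- The conclusion of the theorem. -/
def Good (M : Matrix (Fin 5) (Fin 5) ℤ) : Prop :=
  ∃ σ τ : Equiv.Perm (Fin 5),
      M.submatrix σ τ =
        !![1,1,1,0,0; 1,1,0,1,0; 1,0,1,1,0; 0,1,1,1,1; 1,0,0,0,1] ∨
      M.submatrix σ τ =
        !![1,1,1,0,0; 1,0,0,1,0; 0,1,0,1,0; 0,0,1,1,1; 1,1,0,0,1] ∨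
      M.submatrix σ τ =
        !![1,1,1,0,0; 1,1,0,1,0; 1,0,1,1,1; 0,1,1,1,1; 1,1,0,0,1]

theorem Good.of_submatrix {M : Matrix (Fin 5) (Fin 5) ℤ} {α β : Equiv.Perm (Fin 5)}
    (h : Good (M.submatrix α β)) : Good M := by
  obtain ⟨σ, τ, h⟩ := h
  refine ⟨σ.trans α, τ.trans β, ?_⟩
  simpa [Matrix.submatrix_submatrix] using h

theorem table_good : ∀ t ∈ table, Good (mat ![t.1, t.2.1, t.2.2.1, t.2.2.2.1, t.2.2.2.2]) := by
  simp only [table, List.forall_mem_cons]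
  refine ⟨?_, ?_, ?_, ?_, ?_, ?_, ?_, ?_, ?_, ?_, ?_, by simp⟩
  · exact ⟨⟨![3, 1, 0, 4, 2], ![2, 1, 4, 0, 3], by decide, by decide⟩,
      ⟨![2, 3, 0, 4, 1], ![2, 4, 0, 1, 3], by decide, by decide⟩, Or.inr (Or.inl (by decide))⟩
  · exact ⟨⟨![3, 1, 0, 4, 2], ![2, 1, 4, 0, 3], by decide, by decide⟩,
      ⟨![2, 4, 0, 3, 1], ![2, 4, 0, 3, 1], by decide, by decide⟩, Or.inr (Or.inl (by decide))⟩
  · exact ⟨⟨![4, 1, 0, 3, 2], ![2, 1, 4, 3, 0], by decide, by decide⟩,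
      ⟨![1, 3, 0, 4, 2], ![2, 0, 4, 1, 3], by decide, by decide⟩, Or.inr (Or.inl (by decide))⟩
  · exact ⟨⟨![4, 1, 0, 3, 2], ![2, 1, 4, 3, 0], by decide, by decide⟩,
      ⟨![1, 4, 0, 3, 2], ![2, 0, 4, 3, 1], by decide, by decide⟩, Or.inr (Or.inl (by decide))⟩
  · exact ⟨⟨![4, 2, 0, 1, 3], ![2, 3, 1, 4, 0], by decide, by decide⟩,
      ⟨![0, 3, 1, 4, 2], ![0, 2, 4, 1, 3], by decide, by decide⟩, Or.inr (Or.inl (by decide))⟩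
  · exact ⟨⟨![4, 2, 0, 1, 3], ![2, 3, 1, 4, 0], by decide, by decide⟩,
      ⟨![0, 4, 1, 3, 2], ![0, 2, 4, 3, 1], by decide, by decide⟩, Or.inr (Or.inl (by decide))⟩
  · exact ⟨⟨![3, 2, 1, 4, 0], ![4, 2, 1, 0, 3], by decide, by decide⟩,
      ⟨![4, 0, 1, 2, 3], ![1, 2, 3, 4, 0], by decide, by decide⟩, Or.inl (by decide)⟩
  · exact ⟨⟨![3, 2, 1, 4, 0], ![4, 2, 1, 0, 3], by decide, by decide⟩,
      ⟨![3, 0, 1, 2, 4], ![1, 2, 3, 0, 4], by decide, by decide⟩, Or.inl (by decide)⟩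
  · exact ⟨⟨![2, 1, 4, 3, 0], ![4, 1, 0, 3, 2], by decide, by decide⟩,
      ⟨![3, 4, 0, 1, 2], ![2, 3, 4, 0, 1], by decide, by decide⟩, Or.inr (Or.inr (by decide))⟩
  · exact ⟨⟨![2, 1, 4, 3, 0], ![4, 1, 0, 3, 2], by decide, by decide⟩,
      ⟨![2, 4, 0, 1, 3], ![2, 3, 0, 4, 1], by decide, by decide⟩, Or.inr (Or.inr (by decide))⟩
  · exact ⟨⟨![2, 1, 4, 3, 0], ![4, 1, 0, 3, 2], by decide, by decide⟩,
      ⟨![2, 3, 0, 1, 4], ![2, 3, 0, 1, 4], by decide, by decide⟩, Or.inr (Or.inr (by decide))⟩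

theorem cast_n (x : Bool) : ((n x : ℕ) : ZMod 16) = ((v x : ℤ) : ZMod 16) := by
  cases x <;> simp [n, v]

theorem cast_sel (x : Bool) (m : ℕ) :
    ((sel x m : ℕ) : ZMod 16) = ((v x : ℤ) : ZMod 16) * (m : ZMod 16) := by
  cases x <;> simp [sel, v]

theorem fifteen : (15 : ZMod 16) = -1 := by decide

set_option maxHeartbeats 4000000 in
theorem search_spec {r0 : R} {l : List R} (h : search r0 l = true) {r1 r2 r3 r4 : R}
    (hs : [r1, r2, r3, r4].Sublist l)
    (hdet : (mat ![r0, r1, r2, r3, r4]).det = 5 ∨ (mat ![r0, r1, r2, r3, r4]).det = -5) :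
    Good (mat ![r0, r1, r2, r3, r4]) := by
  unfold search at h
  obtain ⟨l1, hs1, h1⟩ := loop_spec h hs
  simp only [minors2] at h1
  obtain ⟨l2, hs2, h2⟩ := loop_spec h1 hs1
  simp only [minors3] at h2
  obtain ⟨l3, hs3, h3⟩ := loop_spec h2 hs2
  simp only [minors4] at h3
  obtain ⟨l4, hs4, h4⟩ := loop_spec h3 hs3
  clear h h1 h2 h3
  generalize hD : det5 r4 _ _ _ _ _ = D at h4
  have hc : (D : ZMod 16) = (((mat ![r0, r1, r2, r3, r4]).det : ℤ) : ZMod 16) := by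
    rw [← hD]
    simp only [det5, Nat.cast_add, Nat.cast_mul, cast_sel, cast_n, Nat.cast_ofNat, fifteen]
    rw [Matrix.det_succ_row_zero]
    simp only [Matrix.det_succ_row_zero, Fin.sum_univ_succ, mat, get, Matrix.submatrix_apply,
      Fin.succAbove, Finset.univ_unique, Finset.sum_singleton]
    simp [Fin.lt_def]
    ring
  have hm : D % 16 = 5 ∨ D % 16 = 11 := by
    rcases hdet with e | e <;> rw [e] at hc
    · left
      have : (D : ZMod 16) = ((5 : ℕ) : ZMod 16) := by rw [hc]; rfl
      exact (ZMod.natCast_eq_natCast_iff' _ _ _).1 this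
    · right
      have : (D : ZMod 16) = ((11 : ℕ) : ZMod 16) := by rw [hc]; rfl
      exact (ZMod.natCast_eq_natCast_iff' _ _ _).1 this
  have ht : (table.any fun t => beq t.1 r0 && beq t.2.1 r1 && beq t.2.2.1 r2 &&
      beq t.2.2.2.1 r3 && beq t.2.2.2.2 r4) = true := by
    unfold leaf at h4
    rcases hm with e | e <;> rw [e] at h4 <;> exact h4
  obtain ⟨t, htm, hb⟩ := List.any_eq_true.1 ht
  simp only [Bool.and_eq_true] at hb
  obtain ⟨⟨⟨⟨b0, b1⟩, b2⟩, b3⟩, b4⟩ := hb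
  have := table_good t htm
  rwa [eq_of_beq b0, eq_of_beq b1, eq_of_beq b2, eq_of_beq b3, eq_of_beq b4] at this

theorem det_perm {M : Matrix (Fin 5) (Fin 5) ℤ} (hdet : M.det = 5 ∨ M.det = -5)
    (σ τ : Equiv.Perm (Fin 5)) :
    (M.submatrix σ τ).det = 5 ∨ (M.submatrix σ τ).det = -5 := by
  have e : M.submatrix σ τ = (M.submatrix σ id).submatrix id τ := by
    simp [Matrix.submatrix_submatrix]
  rw [e, Matrix.det_permute', Matrix.det_permute]
  rcases Int.units_eq_one_or (Equiv.Perm.sign σ) with h1 | h1 <;>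
  rcases Int.units_eq_one_or (Equiv.Perm.sign τ) with h2 | h2 <;>
  rcases hdet with h | h <;> simp [h1, h2, h]

theorem key {ρ : Fin 5 → R} (hdet : (mat ρ).det = 5 ∨ (mat ρ).det = -5) {w : ℕ}
    (hw : search (canon w) (L w) = true) (h0 : ρ 0 = canon w)
    (hmin : ∀ i, w ≤ (ρ i).weight) : Good (mat ρ) := by
  have hinj : Function.Injective ρ := by
    intro i j hij
    by_contra hne
    have : (mat ρ).det = 0 := Matrix.det_zero_of_row_eq hne (by simp [mat, hij])
    omega
  have hnd : [ρ 1, ρ 2, ρ 3, ρ 4].Nodup := by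
    simp [hinj.eq_iff]
  have hsub : [ρ 1, ρ 2, ρ 3, ρ 4] ⊆ L w := by
    intro r hr
    simp only [List.mem_cons, List.not_mem_nil, or_false] at hr
    rcases hr with rfl | rfl | rfl | rfl <;> exact mem_L (hmin _)
  obtain ⟨l, hp, hl⟩ := List.subperm_of_subset hnd hsub
  have hlen := hp.length_eq
  obtain ⟨s1, s2, s3, s4, rfl⟩ : ∃ a b c d, l = [a, b, c, d] := by
    match l, hlen with
    | [a, b, c, d], _ => exact ⟨a, b, c, d, rfl⟩
  set g : Fin 5 → R := ![ρ 0, s1, s2, s3, s4] with hg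
  have hpp : List.Perm (List.ofFn g) (List.ofFn ρ) := by
    have e1 : List.ofFn g = ρ 0 :: [s1, s2, s3, s4] := by simp [hg, List.ofFn_succ]
    have e2 : List.ofFn ρ = ρ 0 :: [ρ 1, ρ 2, ρ 3, ρ 4] := by
      simp [List.ofFn_succ]
    rw [e1, e2]
    exact hp.cons _
  have hginj : Function.Injective g :=
    List.nodup_ofFn.1 (hpp.nodup_iff.2 (List.nodup_ofFn.2 hinj))
  have hex : ∀ i, ∃ j, ρ j = g i := fun i => by
    have : g i ∈ List.ofFn ρ := hpp.subset (List.mem_ofFn.2 ⟨i, rfl⟩)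
    exact List.mem_ofFn.1 this
  choose f hf using hex
  have hfinj : Function.Injective f := fun i j h => hginj (by rw [← hf, ← hf, h])
  let σ : Equiv.Perm (Fin 5) := Equiv.ofBijective f (Finite.injective_iff_bijective.1 hfinj)
  have e : (mat ρ).submatrix σ (1 : Equiv.Perm (Fin 5)) = mat g := by
    ext i j
    simp [mat, σ, hf]
  have hd := det_perm hdet σ 1
  rw [e] at hd
  refine Good.of_submatrix (α := σ) (β := 1) ?_
  rw [e]
  rw [hg, h0] at hd ⊢
  exact search_spec hw hl hd

theorem exists_row {f : Fin 5 → ℤ} (h : ∀ j, f j = 0 ∨ f j = 1) : ∃ r : R, r.get = f := by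
  refine ⟨⟨f 0 == 1, f 1 == 1, f 2 == 1, f 3 == 1, f 4 == 1⟩, ?_⟩
  ext j
  fin_cases j
  · rcases h 0 with e | e <;> simp [get, v, e]
  · rcases h 1 with e | e <;> simp [get, v, e]
  · rcases h 2 with e | e <;> simp [get, v, e]
  · rcases h 3 with e | e <;> simp [get, v, e]
  · rcases h 4 with e | e <;> simp [get, v, e]

theorem exists_rows {M : Matrix (Fin 5) (Fin 5) ℤ} (h : ∀ i j, M i j = 0 ∨ M i j = 1) :
    ∃ ρ, mat ρ = M := by
  choose ρ hρ using fun i => exists_row (h i)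
  exact ⟨ρ, funext hρ⟩

theorem weight_eq (r : R) : (r.weight : ℤ) = ∑ j, r.get j := by
  have : ∀ x, ((n x : ℕ) : ℤ) = v x := by intro x; cases x <;> rfl
  simp [Fin.sum_univ_five, get, weight, this]

theorem eq_canon {r : R} (h : Monotone r.get) : r = canon r.weight := by
  have h1 := h (show (0 : Fin 5) ≤ 1 by decide)
  have h2 := h (show (1 : Fin 5) ≤ 2 by decide)
  have h3 := h (show (2 : Fin 5) ≤ 3 by decide)
  have h4 := h (show (3 : Fin 5) ≤ 4 by decide)
  clear h
  rcases r with ⟨a, b, c, d, e⟩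
  revert a b c d e
  simp only [get, Matrix.cons_val]
  intro a b c d e
  cases a <;> cases b <;> cases c <;> cases d <;> cases e <;>
    simp [v] <;> exact eq_of_beq (by decide)

theorem main {M : Matrix (Fin 5) (Fin 5) ℤ} (hbin : ∀ i j, M i j = 0 ∨ M i j = 1)
    (hdet : M.det = 5 ∨ M.det = -5) : Good M := by
  obtain ⟨i, hi⟩ := Finite.exists_min fun i => ∑ j, M i j
  let τ : Equiv.Perm (Fin 5) := Tuple.sort (M i)
  have hmono : Monotone (M i ∘ τ) := Tuple.monotone_sort (M i)
  let σ : Equiv.Perm (Fin 5) := Equiv.swap 0 i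
  obtain ⟨ρ, hρ⟩ := exists_rows (M := M.submatrix σ τ) fun a b => hbin _ _
  have hd := det_perm hdet σ τ
  refine Good.of_submatrix (α := σ) (β := τ) ?_
  rw [← hρ] at hd ⊢
  have hget : ∀ k, (ρ k).get = fun j => M (σ k) (τ j) := fun k => by
    have := congrFun hρ k
    exact this
  have hσ : σ 0 = i := Equiv.swap_apply_left _ _
  have hwt : ∀ k, ((ρ k).weight : ℤ) = ∑ j, M (σ k) j := fun k => by
    rw [weight_eq, hget]
    exact Equiv.sum_comp τ (M (σ k))
  have hmin : ∀ k, (ρ 0).weight ≤ (ρ k).weight := fun k => by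
    have := hi (σ k)
    zify
    rw [hwt, hwt, hσ]
    exact this
  have hc : ρ 0 = canon (ρ 0).weight := by
    apply eq_canon
    rw [hget, hσ]
    exact hmono
  have hle : (ρ 0).weight ≤ 5 := by
    have : ∀ x, n x ≤ 1 := by intro x; cases x <;> simp [n]
    have h1 := this (ρ 0).a
    have h2 := this (ρ 0).b
    have h3 := this (ρ 0).c
    have h4 := this (ρ 0).d
    have h5 := this (ρ 0).e
    unfold weight
    omega
  generalize (ρ 0).weight = w at *
  have h0 : w = 0 → False := by
    rintro rfl
    have : (mat ρ).det = 0 := by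
      apply Matrix.det_eq_zero_of_row_eq_zero 0
      intro j
      simp only [mat, hc]
      fin_cases j <;> rfl
    omega
  interval_cases w
  · exact (h0 rfl).elim
  · exact key hd search1 hc hmin
  · exact key hd search2 hc hmin
  · exact key hd search3 hc hmin
  · exact key hd search4 hc hmin
  · exact key hd search5 hc hmin

end R


/-- A 5×5 binary matrix invertible over ℤ/2 with integer determinant ±5 is equivalent,
up to permutation of rows and columns, to one of three explicit matrices. -/
theorem stmt_6 (M : Matrix (Fin 5) (Fin 5) ℤ)
    (hbin : ∀ i j, M i j = 0 ∨ M i j = 1)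
    (hinv : (M.map (Int.cast : ℤ → ZMod 2)).det ≠ 0)
    (hdet : M.det = 5 ∨ M.det = -5) :
    ∃ σ τ : Equiv.Perm (Fin 5),
      M.submatrix σ τ =
        !![1,1,1,0,0; 1,1,0,1,0; 1,0,1,1,0; 0,1,1,1,1; 1,0,0,0,1] ∨
      M.submatrix σ τ =
        !![1,1,1,0,0; 1,0,0,1,0; 0,1,0,1,0; 0,0,1,1,1; 1,1,0,0,1] ∨
      M.submatrix σ τ =
        !![1,1,1,0,0; 1,1,0,1,0; 1,0,1,1,1; 0,1,1,1,1; 1,1,0,0,1] := by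
  exact R.main hbin hdet
end
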